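/- arXiv:1308.2136 — 2 statements merged into one kernel-verified Lean document; each statement's English description precedes it below -/
import Mathlib

section
/- Let f be as in the context with f(0,0) = 0, f_v(0,0) = 0, f_u(0,0) ≠ 0, with f_u(0,0) and f_vv(0,0) linearly independent (non-degeneracy), and with det(f_u(0,0), f_uv(0,0), f_vv(0,0)) = 0 (Whitney's condition that (0,0) is not a cross cap). Then there exist ε > 0 and a C^∞ function u : (−ε, ε) → ℝ with u(0) = 0 and u'(0) = 0 such that ⟨f(u(v), v), f_u(0,0)⟩ = 0 for all |v| < ε, and the plane section curve σ(t) := f(u(t), t) satisfies: σ'(0) = 0; det(f_u(0,0), σ''(0), σ'''(0)) = det(f_u(0,0), f_vv(0,0), f_vvv(0,0)); and ‖σ''(0)‖² · ‖f_u(0,0)‖² = ‖f_u(0,0) × f_vv(0,0)‖². Consequently the cuspidal curvature of the planar curve σ (the section of the surface by the plane through f(0,0) orthogonal to f_u(0,0)) equals the cuspidal curvature κ_c of the singular point. -/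
open scoped RealInnerProductSpace
open Filter

noncomputable section

/-- Euclidean 3-space. -/
abbrev E3 : Type := EuclideanSpace ℝ (Fin 3)

/-- Partial derivative in the first (`u`) direction. -/
def pu {E : Type*} [NormedAddCommGroup E] [NormedSpace ℝ E] (f : ℝ × ℝ → E) (q : ℝ × ℝ) : E :=
  fderiv ℝ f q (1, 0)

/-- Partial derivative in the second (`v`) direction. -/
def pv {E : Type*} [NormedAddCommGroup E] [NormedSpace ℝ E] (f : ℝ × ℝ → E) (q : ℝ × ℝ) : E :=
  fderiv ℝ f q (0, 1)

/-- Determinant of three column vectors in `ℝ³`. -/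
def det3 (a b c : E3) : ℝ :=
  Matrix.det !![a 0, b 0, c 0; a 1, b 1, c 1; a 2, b 2, c 2]

/-- Cross product in `ℝ³`. -/
def cross3 (a b : E3) : E3 :=
  (WithLp.equiv 2 (Fin 3 → ℝ)).symm
    ![a 1 * b 2 - a 2 * b 1, a 2 * b 0 - a 0 * b 2, a 0 * b 1 - a 1 * b 0]

theorem ContDiff.pu {E : Type*} [NormedAddCommGroup E] [NormedSpace ℝ E] {g : ℝ × ℝ → E}
    (hg : ContDiff ℝ (⊤ : ℕ∞) g) : ContDiff ℝ (⊤ : ℕ∞) (_root_.pu g) :=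
  (hg.fderiv_right (m := (⊤ : ℕ∞)) (by simp)).clm_apply contDiff_const

theorem ContDiff.pv {E : Type*} [NormedAddCommGroup E] [NormedSpace ℝ E] {g : ℝ × ℝ → E}
    (hg : ContDiff ℝ (⊤ : ℕ∞) g) : ContDiff ℝ (⊤ : ℕ∞) (_root_.pv g) :=
  (hg.fderiv_right (m := (⊤ : ℕ∞)) (by simp)).clm_apply contDiff_const

theorem fderiv_apply_eq_pu_pv {E : Type*} [NormedAddCommGroup E] [NormedSpace ℝ E]
    (g : ℝ × ℝ → E) (q : ℝ × ℝ) (x y : ℝ) :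
    fderiv ℝ g q (x, y) = x • pu g q + y • pv g q := by
  rw [pu, pv, ← map_smul, ← map_smul, ← map_add]
  simp

/-- Mixed partial derivatives of a smooth function commute. -/
theorem pu_pv_eq_pv_pu {E : Type*} [NormedAddCommGroup E] [NormedSpace ℝ E] {g : ℝ × ℝ → E}
    (hg : ContDiff ℝ (⊤ : ℕ∞) g) (q : ℝ × ℝ) : pu (pv g) q = pv (pu g) q := by
  have hd : DifferentiableAt ℝ (fderiv ℝ g) q :=
    ((hg.fderiv_right (m := (⊤ : ℕ∞)) (by simp)).differentiable (by simp)) q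
  have key (w z : ℝ × ℝ) :
      fderiv ℝ (fun p => fderiv ℝ g p w) q z = fderiv ℝ (fderiv ℝ g) q z w := by
    simp [fderiv_clm_apply hd (differentiableAt_const w)]
  have hs : IsSymmSndFDerivAt ℝ g q := hg.contDiffAt.isSymmSndFDerivAt
    (by simpa using
      (WithTop.coe_le_coe.2 le_top : ((2 : ℕ∞) : WithTop ℕ∞) ≤ ((⊤ : ℕ∞) : WithTop ℕ∞)))
  change fderiv ℝ (fun p => fderiv ℝ g p (0, 1)) q (1, 0) =
    fderiv ℝ (fun p => fderiv ℝ g p (1, 0)) q (0, 1)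
  rw [key, key]
  exact hs _ _

/-- Chain rule along the curve `t ↦ (U t, t)`. -/
theorem hasDerivAt_comp_graph {E : Type*} [NormedAddCommGroup E] [NormedSpace ℝ E]
    {g : ℝ × ℝ → E} {U : ℝ → ℝ} (hg : ContDiff ℝ (⊤ : ℕ∞) g) (hU : ContDiff ℝ (⊤ : ℕ∞) U)
    (t : ℝ) :
    HasDerivAt (fun s => g (U s, s)) (deriv U t • pu g (U t, t) + pv g (U t, t)) t := by
  have h1 := (hg.differentiable (by simp) (U t, t)).hasFDerivAt.comp_hasDerivAt
    (f := fun s => (U s, s)) t (((hU.differentiable (by simp) t).hasDerivAt).prodMk (hasDerivAt_id t))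
  rw [fderiv_apply_eq_pu_pv, one_smul] at h1
  exact h1

theorem contDiff_deriv_top {U : ℝ → ℝ} (hU : ContDiff ℝ (⊤ : ℕ∞) U) :
    ContDiff ℝ (⊤ : ℕ∞) (deriv U) :=
  (contDiff_infty_iff_deriv.1 hU).2

/-- The linear isomorphism `(x, y) ↦ (a x + b y, y)` of the plane, for `a ≠ 0`. -/
def shearEquiv (a b : ℝ) (ha : a ≠ 0) : (ℝ × ℝ) ≃L[ℝ] ℝ × ℝ :=
  LinearEquiv.toContinuousLinearEquiv
    { toFun := fun p => (p.1 * a + p.2 * b, p.2)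
      invFun := fun p => (a⁻¹ * (p.1 - p.2 * b), p.2)
      map_add' := fun p q => by ext <;> simp; ring
      map_smul' := fun c p => by ext <;> simp; ring
      left_inv := fun p => by ext <;> simp; field_simp
      right_inv := fun p => by ext <;> simp; field_simp; ring }

/-- A smooth function near `0` agrees near `0` with a globally smooth function. -/
theorem exists_contDiff_eq_near {V : ℝ → ℝ} {r : ℝ} (hr : 0 < r)
    (hV : ∀ t ∈ Metric.ball (0 : ℝ) r, ContDiffAt ℝ (⊤ : ℕ∞) V t) :
    ∃ ε > 0, ∃ U : ℝ → ℝ, ContDiff ℝ (⊤ : ℕ∞) U ∧ ∀ t, |t| < ε → U t = V t := by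
  let χ : ContDiffBump (0 : ℝ) := ⟨r / 4, r / 2, by positivity, by linarith⟩
  refine ⟨r / 4, by positivity, fun t => χ t * V t, ?_, fun t ht => ?_⟩
  · refine contDiff_iff_contDiffAt.2 fun t => ?_
    by_cases ht : t ∈ tsupport χ
    · rw [χ.tsupport_eq] at ht
      exact χ.contDiffAt.mul
        (hV t (Metric.closedBall_subset_ball (by change r / 2 < r; linarith) ht))
    · refine (contDiffAt_const (c := (0 : ℝ))).congr_of_eventuallyEq ?_
      filter_upwards [notMem_tsupport_iff_eventuallyEq.1 ht] with s hs
      simp [hs]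
  · have : χ t = 1 := χ.one_of_mem_closedBall (by
      simpa [Real.norm_eq_abs] using ht.le)
    simp [this]

/-- A smooth implicit function theorem in the plane, with a globally smooth solution. -/
theorem exists_contDiff_implicit {F : ℝ × ℝ → ℝ} (hF : ContDiff ℝ (⊤ : ℕ∞) F)
    (h0 : F (0, 0) = 0) (hu : pu F (0, 0) ≠ 0) :
    ∃ ε > 0, ∃ U : ℝ → ℝ, ContDiff ℝ (⊤ : ℕ∞) U ∧ U 0 = 0 ∧
      ∀ t, |t| < ε → F (U t, t) = 0 := by
  let Φ : ℝ × ℝ → ℝ × ℝ := fun p => (F p, p.2)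
  have hΦ : ContDiff ℝ (⊤ : ℕ∞) Φ := hF.prodMk contDiff_snd
  have hΦ' (q : ℝ × ℝ) (hq : pu F q ≠ 0) :
      HasFDerivAt Φ (shearEquiv (pu F q) (pv F q) hq : ℝ × ℝ →L[ℝ] ℝ × ℝ) q := by
    have h := (hF.differentiable (by simp) q).hasFDerivAt.prodMk
      (hasFDerivAt_snd (𝕜 := ℝ) (p := q))
    refine h.congr_fderiv (ContinuousLinearMap.ext fun p => ?_)
    have := fderiv_apply_eq_pu_pv F q p.1 p.2
    exact Prod.ext this rfl
  let e := hΦ.contDiffAt.toOpenPartialHomeomorph Φ (hΦ' _ hu) (by simp)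
  have he : (e : ℝ × ℝ → ℝ × ℝ) = Φ := rfl
  have hsrc : ((0 : ℝ), (0 : ℝ)) ∈ e.source :=
    hΦ.contDiffAt.mem_toOpenPartialHomeomorph_source (hΦ' _ hu) (by simp)
  have hΦ0 : Φ (0, 0) = (0, 0) := by simp [Φ, h0]
  have htgt : ((0 : ℝ), (0 : ℝ)) ∈ e.target := by
    have := e.map_source hsrc
    rwa [he, hΦ0] at this
  have hsymm0 : e.symm (0, 0) = (0, 0) := by
    have := e.left_inv hsrc
    rwa [he, hΦ0] at this
  have hopen : IsOpen (e.target ∩ e.symm ⁻¹' {q | pu F q ≠ 0}) :=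
    e.isOpen_inter_preimage_symm (isOpen_ne_fun hF.pu.continuous continuous_const)
  have hcont : Continuous fun t : ℝ => ((0 : ℝ), t) := by fun_prop
  obtain ⟨r, hr, hball⟩ := Metric.isOpen_iff.1 (hopen.preimage hcont) 0
    ⟨htgt, by simpa [hsymm0] using hu⟩
  obtain ⟨δ, hδ, U, hU, hUV⟩ := exists_contDiff_eq_near (V := fun t => (e.symm (0, t)).1) hr
    fun t ht => by
      have h := e.contDiffAt_symm (hball ht).1 (hΦ' _ (hball ht).2) hΦ.contDiffAt
      exact contDiffAt_fst.comp t (h.comp t (contDiffAt_const.prodMk contDiffAt_id))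
  refine ⟨min δ r, lt_min hδ hr, U, hU, ?_, fun t ht => ?_⟩
  · simp [hUV 0 (by simpa using hδ), hsymm0]
  · have ht2 : (0, t) ∈ e.target :=
      (hball (by simpa [Real.norm_eq_abs] using ht.trans_le (min_le_right _ _))).1
    have h : Φ (e.symm (0, t)) = (0, t) := e.right_inv ht2
    have h2 : (e.symm (0, t)).2 = t := congrArg Prod.snd h
    have h3 : (U t, t) = e.symm (0, t) :=
      Prod.ext (hUV t (ht.trans_le (min_le_left _ _))) h2.symm
    rw [h3]
    exact congrArg Prod.fst h

/-- Derivatives at `0` of `t ↦ f (U t, t)` up to order three, when `U` vanishes to first order. -/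
theorem derivs_comp_graph {E : Type*} [NormedAddCommGroup E] [NormedSpace ℝ E]
    {f : ℝ × ℝ → E} {U : ℝ → ℝ} (hf : ContDiff ℝ (⊤ : ℕ∞) f) (hU : ContDiff ℝ (⊤ : ℕ∞) U)
    (hU0 : U 0 = 0) (hU1 : deriv U 0 = 0) :
    deriv (fun t => f (U t, t)) 0 = pv f (0, 0) ∧
    deriv (deriv (fun t => f (U t, t))) 0 =
      deriv (deriv U) 0 • pu f (0, 0) + pv (pv f) (0, 0) ∧
    deriv (deriv (deriv (fun t => f (U t, t)))) 0 =
      deriv (deriv (deriv U)) 0 • pu f (0, 0) +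
        (3 * deriv (deriv U) 0) • pv (pu f) (0, 0) + pv (pv (pv f)) (0, 0) := by
  have hd (t : ℝ) : HasDerivAt (deriv U) (deriv (deriv U) t) t :=
    ((contDiff_deriv_top hU).differentiable (by simp) t).hasDerivAt
  have hdd (t : ℝ) : HasDerivAt (deriv (deriv U)) (deriv (deriv (deriv U)) t) t :=
    ((contDiff_deriv_top (contDiff_deriv_top hU)).differentiable (by simp) t).hasDerivAt
  have h1 : deriv (fun t => f (U t, t)) =
      fun t => deriv U t • pu f (U t, t) + pv f (U t, t) :=
    funext fun t => (hasDerivAt_comp_graph hf hU t).deriv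
  have h2 : deriv (deriv (fun t => f (U t, t))) = fun t =>
      (deriv U t • (deriv U t • pu (pu f) (U t, t) + pv (pu f) (U t, t)) +
        deriv (deriv U) t • pu f (U t, t)) +
      (deriv U t • pu (pv f) (U t, t) + pv (pv f) (U t, t)) := by
    rw [h1]
    exact funext fun t => (((hd t).smul (hasDerivAt_comp_graph hf.pu hU t)).add
      (hasDerivAt_comp_graph hf.pv hU t)).deriv
  refine ⟨by simp [h1, hU0, hU1], by simp [h2, hU0, hU1], ?_⟩
  rw [h2]
  have h3 := (((hd 0).smul (((hd 0).smul (hasDerivAt_comp_graph hf.pu.pu hU 0)).add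
      (hasDerivAt_comp_graph hf.pu.pv hU 0))).add
      ((hdd 0).smul (hasDerivAt_comp_graph hf.pu hU 0))).add
      (((hd 0).smul (hasDerivAt_comp_graph hf.pv.pu hU 0)).add
      (hasDerivAt_comp_graph hf.pv.pv hU 0))
  refine h3.deriv.trans ?_
  simp only [hU0, hU1, pu_pv_eq_pv_pu hf, Pi.add_apply, Pi.smul_apply',
    zero_smul, zero_add]
  module

theorem det3_shear {a b c d : E3} (x y z : ℝ) (h : det3 a c b = 0) :
    det3 a (x • a + b) (y • a + z • c + d) = det3 a b d := by
  simp only [det3, Matrix.det_fin_three, Matrix.of_apply, Matrix.cons_val', Matrix.cons_val,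
    PiLp.add_apply, PiLp.smul_apply, smul_eq_mul] at h ⊢
  linear_combination -z * h

/-- Lagrange's identity for a vector `x • a + b` orthogonal to `a`. -/
theorem norm_sq_mul_norm_sq_eq_cross3 {a b : E3} {x : ℝ} (h : ⟪x • a + b, a⟫ = 0) :
    ‖x • a + b‖ ^ 2 * ‖a‖ ^ 2 = ‖cross3 a b‖ ^ 2 := by
  simp only [EuclideanSpace.norm_sq_eq, Fin.sum_univ_three, Real.norm_eq_abs, sq_abs, cross3,
    WithLp.equiv_symm_apply, Matrix.cons_val, PiLp.add_apply, PiLp.smul_apply, smul_eq_mul,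
    PiLp.inner_apply, RCLike.inner_apply, conj_trivial] at h ⊢
  linear_combination (a 0 * (x * a 0 + b 0) + a 1 * (x * a 1 + b 1) + a 2 * (x * a 2 + b 2)) * h

/-- **Geometric meaning of the cuspidal curvature.** At a non-degenerate singular point of the
first kind which is not a cross cap, the section of the surface by the plane through `f(0,0)`
orthogonal to `f_u(0,0)` is a curve `σ(t) = f(u(t), t)` with `σ'(0) = 0` whose data computes
the cuspidal curvature: `det(f_u, σ'', σ''') = det(f_u, f_vv, f_vvv)` and
`‖σ''(0)‖²‖f_u(0,0)‖² = ‖f_u(0,0) × f_vv(0,0)‖²`; hence the cuspidal curvature of the planar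
cusp `σ` equals `κ_c`. -/
theorem cuspidal_curvature_of_plane_section
    (f : ℝ × ℝ → E3) (hf : ContDiff ℝ (⊤ : ℕ∞) f)
    (h0 : f (0, 0) = 0) (hfv : pv f (0, 0) = 0) (hfu : pu f (0, 0) ≠ 0)
    (hnd : LinearIndependent ℝ ![pu f (0, 0), pv (pv f) (0, 0)])
    (hWhitney : det3 (pu f (0, 0)) (pv (pu f) (0, 0)) (pv (pv f) (0, 0)) = 0) :
    ∃ (ε : ℝ) (U : ℝ → ℝ), 0 < ε ∧ ContDiff ℝ (⊤ : ℕ∞) U ∧ U 0 = 0 ∧ deriv U 0 = 0 ∧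
      (∀ v : ℝ, |v| < ε → ⟪f (U v, v), pu f (0, 0)⟫ = 0) ∧
      deriv (fun t => f (U t, t)) 0 = 0 ∧
      det3 (pu f (0, 0)) (deriv (deriv (fun t => f (U t, t))) 0)
          (deriv (deriv (deriv (fun t => f (U t, t)))) 0) =
        det3 (pu f (0, 0)) (pv (pv f) (0, 0)) (pv (pv (pv f)) (0, 0)) ∧
      ‖deriv (deriv (fun t => f (U t, t))) 0‖ ^ 2 * ‖pu f (0, 0)‖ ^ 2 =
        ‖cross3 (pu f (0, 0)) (pv (pv f) (0, 0))‖ ^ 2 := by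
  set a := pu f (0, 0)
  let F : ℝ × ℝ → ℝ := fun p => ⟪f p, a⟫
  have hF : ContDiff ℝ (⊤ : ℕ∞) F := hf.inner ℝ contDiff_const
  have hF' (w : ℝ × ℝ) : fderiv ℝ F (0, 0) w = ⟪fderiv ℝ f (0, 0) w, a⟫ := by
    simp [F, fderiv_inner_apply ℝ (hf.differentiable (by simp) (0, 0)) (differentiableAt_const a)]
  have hpu : pu F (0, 0) = ⟪a, a⟫ := hF' _
  have hpv : pv F (0, 0) = 0 := by
    have : pv F (0, 0) = ⟪pv f (0, 0), a⟫ := hF' _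
    rw [this, hfv, inner_zero_left]
  have haa : ⟪a, a⟫ ≠ 0 := inner_self_ne_zero.2 hfu
  obtain ⟨ε, hε, U, hU, hU0, hFU⟩ := exists_contDiff_implicit hF (by simp [F, h0]) (hpu ▸ haa)
  have hev : (fun t => F (U t, t)) =ᶠ[nhds 0] fun _ => 0 := by
    filter_upwards [Metric.ball_mem_nhds (0 : ℝ) hε] with t ht
    exact hFU t (by simpa [Real.norm_eq_abs] using ht)
  have hU1 : deriv U 0 = 0 := by
    have h := (hasDerivAt_comp_graph hF hU 0).deriv
    rw [hev.deriv_eq, deriv_const, hU0, hpv, hpu, add_zero, smul_eq_mul] at h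
    exact (mul_eq_zero.1 h.symm).resolve_right haa
  obtain ⟨h1, h2, h3⟩ := derivs_comp_graph hf hU hU0 hU1
  have hperp : ⟪deriv (deriv U) 0 • a + pv (pv f) (0, 0), a⟫ = 0 := by
    have hσ : ContDiff ℝ (⊤ : ℕ∞) fun t => f (U t, t) := hf.comp (hU.prodMk contDiff_id)
    have hσ' := (contDiff_infty_iff_deriv.1 hσ).2
    have hd : deriv (fun t => F (U t, t)) = fun t => ⟪deriv (fun s => f (U s, s)) t, a⟫ := by
      funext t
      have := ((hσ.differentiable (by simp) t).hasDerivAt.inner ℝ (hasDerivAt_const t a)).deriv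
      simpa using this
    have hdd : deriv (deriv (fun t => F (U t, t))) 0 =
        ⟪deriv (deriv (fun s => f (U s, s))) 0, a⟫ := by
      rw [hd]
      have := ((hσ'.differentiable (by simp) 0).hasDerivAt.inner ℝ (hasDerivAt_const 0 a)).deriv
      simpa using this
    rw [← h2, ← hdd, hev.deriv.deriv_eq]
    simp
  refine ⟨ε, U, hε, hU, hU0, hU1, hFU, h1.trans hfv, ?_, ?_⟩
  · rw [h2, h3]
    exact det3_shear _ _ _ hWhitney
  · rw [h2]
    exact norm_sq_mul_norm_sq_eq_cross3 hperp
end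
end

section
/- Let f and ν satisfy the adapted coordinate conditions at the first-kind singular point p = (0,0) as in the context. Then the mean curvature function H is bounded on the set of regular points in some neighborhood of p if and only if the cuspidal curvature κ_c(u) := det(f_u(u,0), f_vv(u,0), f_vvv(u,0)) vanishes for all u near 0. -/
open scoped RealInnerProductSpace
open Filter

noncomputable section

/-- Coefficients of the first fundamental form. -/
def Ec (f : ℝ × ℝ → E3) (q : ℝ × ℝ) : ℝ := ⟪pu f q, pu f q⟫
def Fc (f : ℝ × ℝ → E3) (q : ℝ × ℝ) : ℝ := ⟪pu f q, pv f q⟫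
def Gc (f : ℝ × ℝ → E3) (q : ℝ × ℝ) : ℝ := ⟪pv f q, pv f q⟫

/-- Coefficients of the second fundamental form. -/
def Lc (f ν : ℝ × ℝ → E3) (q : ℝ × ℝ) : ℝ := ⟪pu (pu f) q, ν q⟫
def Mc (f ν : ℝ × ℝ → E3) (q : ℝ × ℝ) : ℝ := ⟪pv (pu f) q, ν q⟫
def Nc (f ν : ℝ × ℝ → E3) (q : ℝ × ℝ) : ℝ := ⟪pv (pv f) q, ν q⟫

/-- The mean curvature `H = (E N − 2 F M + G L)/(2(E G − F²))`. -/
def meanCurv (f ν : ℝ × ℝ → E3) (q : ℝ × ℝ) : ℝ :=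
  (Ec f q * Nc f ν q - 2 * Fc f q * Mc f ν q + Gc f q * Lc f ν q) /
    (2 * (Ec f q * Gc f q - Fc f q ^ 2))

/-- The Gaussian curvature `K = (L N − M²)/(E G − F²)`. -/
def gaussCurv (f ν : ℝ × ℝ → E3) (q : ℝ × ℝ) : ℝ :=
  (Lc f ν q * Nc f ν q - Mc f ν q ^ 2) / (Ec f q * Gc f q - Fc f q ^ 2)

section SmoothMaps

variable {E : Type*} [NormedAddCommGroup E] [NormedSpace ℝ E]

theorem contDiff_pu {g : ℝ × ℝ → E} (hg : ContDiff ℝ (⊤ : ℕ∞) g) :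
    ContDiff ℝ (⊤ : ℕ∞) (pu g) :=
  (hg.fderiv_right (m := (⊤ : ℕ∞)) (by exact_mod_cast le_top)).clm_apply contDiff_const

theorem contDiff_pv {g : ℝ × ℝ → E} (hg : ContDiff ℝ (⊤ : ℕ∞) g) :
    ContDiff ℝ (⊤ : ℕ∞) (pv g) :=
  (hg.fderiv_right (m := (⊤ : ℕ∞)) (by exact_mod_cast le_top)).clm_apply contDiff_const

theorem ContDiff.differentiableAt_of_top {g : ℝ × ℝ → E} (hg : ContDiff ℝ (⊤ : ℕ∞) g)
    (q : ℝ × ℝ) : DifferentiableAt ℝ g q :=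
  (hg.differentiable (by simp)) q

theorem hasDerivAt_slice_fst {g : ℝ × ℝ → E} (hg : ContDiff ℝ (⊤ : ℕ∞) g) (u v : ℝ) :
    HasDerivAt (fun s => g (s, v)) (pu g (u, v)) u :=
  (hg.differentiableAt_of_top (u, v)).hasFDerivAt.comp_hasDerivAt u
    ((hasDerivAt_id u).prodMk (hasDerivAt_const u v))

theorem hasDerivAt_slice_snd {g : ℝ × ℝ → E} (hg : ContDiff ℝ (⊤ : ℕ∞) g) (u v : ℝ) :
    HasDerivAt (fun t => g (u, t)) (pv g (u, v)) v :=
  (hg.differentiableAt_of_top (u, v)).hasFDerivAt.comp_hasDerivAt v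
    ((hasDerivAt_const v u).prodMk (hasDerivAt_id v))

theorem pv_pu_eq_pu_pv {g : ℝ × ℝ → E} (hg : ContDiff ℝ (⊤ : ℕ∞) g) (q : ℝ × ℝ) :
    pv (pu g) q = pu (pv g) q := by
  have hd : DifferentiableAt ℝ (fderiv ℝ g) q :=
    ((hg.fderiv_right (m := (⊤ : ℕ∞)) (by exact_mod_cast le_top)).differentiable (by simp)) q
  have hsymm : IsSymmSndFDerivAt ℝ g q :=
    hg.contDiffAt.isSymmSndFDerivAt (by
      rw [minSmoothness_of_isRCLikeNormedField]
      exact WithTop.coe_le_coe.2 le_top)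
  have key : ∀ a b : ℝ × ℝ, fderiv ℝ (fun x => fderiv ℝ g x a) q b
      = fderiv ℝ (fderiv ℝ g) q b a := fun a b => by
    rw [fderiv_clm_apply hd (differentiableAt_const a)]
    simp
  have h := hsymm (0, 1) (1, 0)
  rw [← key, ← key] at h
  exact h

/-- A map vanishing on the `u`-axis gains one order of vanishing over its `v`-derivative. -/
theorem isBigO_snd_pow_succ {g : ℝ × ℝ → E} (hg : ContDiff ℝ (⊤ : ℕ∞) g)
    (h0 : ∀ᶠ u in nhds (0 : ℝ), g (u, 0) = 0) {n : ℕ}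
    (hpv : pv g =O[nhds ((0, 0) : ℝ × ℝ)] fun q => q.2 ^ n) :
    g =O[nhds ((0, 0) : ℝ × ℝ)] fun q => q.2 ^ (n + 1) := by
  obtain ⟨C, hC, hbound⟩ := hpv.exists_nonneg
  obtain ⟨ε, hε, hball⟩ := Metric.eventually_nhds_iff.1 hbound.bound
  refine Asymptotics.IsBigO.of_bound C ?_
  have hzero : ∀ᶠ q : ℝ × ℝ in nhds (0, 0), g (q.1, 0) = 0 :=
    (continuous_fst.tendsto ((0, 0) : ℝ × ℝ)).eventually h0
  filter_upwards [Metric.ball_mem_nhds _ hε, hzero] with q hq hq0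
  obtain ⟨u, v⟩ := q
  have hq' : |u| < ε ∧ |v| < ε := by
    simpa [Prod.dist_eq, Real.dist_eq] using hq
  have habs : ∀ t ∈ Set.uIcc 0 v, |t| ≤ |v| := fun t ht => by
    simpa using Set.abs_sub_left_of_mem_uIcc ht
  have key := (convex_uIcc (0 : ℝ) v).norm_image_sub_le_of_norm_hasDerivWithin_le
    (f := fun t => g (u, t)) (f' := fun t => pv g (u, t)) (C := C * |v| ^ n)
    (fun t _ => (hasDerivAt_slice_snd hg u t).hasDerivWithinAt)
    (fun t ht => by
      have hlt : |t| < ε := (habs t ht).trans_lt hq'.2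
      have h := hball (y := (u, t)) (by simpa [Prod.dist_eq, Real.dist_eq] using ⟨hq'.1, hlt⟩)
      refine h.trans ?_
      rw [norm_pow, Real.norm_eq_abs]
      exact mul_le_mul_of_nonneg_left (pow_le_pow_left₀ (abs_nonneg t) (habs t ht) n) hC)
    Set.left_mem_uIcc Set.right_mem_uIcc
  simp only at hq0
  simpa [hq0, pow_succ, mul_assoc] using key

theorem isBigO_snd {g : ℝ × ℝ → E} (hg : ContDiff ℝ (⊤ : ℕ∞) g)
    (h0 : ∀ᶠ u in nhds (0 : ℝ), g (u, 0) = 0) :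
    g =O[nhds ((0, 0) : ℝ × ℝ)] fun q => q.2 := by
  have h : pv g =O[nhds ((0, 0) : ℝ × ℝ)] fun q => q.2 ^ 0 := by
    simpa using ((contDiff_pv hg).continuous.tendsto ((0, 0) : ℝ × ℝ)).isBigO_one ℝ
  simpa using isBigO_snd_pow_succ hg h0 h

theorem isBigO_snd_sq {g : ℝ × ℝ → E} (hg : ContDiff ℝ (⊤ : ℕ∞) g)
    (h0 : ∀ᶠ u in nhds (0 : ℝ), g (u, 0) = 0) (h1 : ∀ᶠ u in nhds (0 : ℝ), pv g (u, 0) = 0) :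
    g =O[nhds ((0, 0) : ℝ × ℝ)] fun q => q.2 ^ 2 :=
  isBigO_snd_pow_succ hg h0 (by simpa using isBigO_snd (contDiff_pv hg) h1)

theorem eventually_pv_eq_zero_of_isBigO_snd_sq {g : ℝ × ℝ → E} (hg : ContDiff ℝ (⊤ : ℕ∞) g)
    (h0 : ∀ᶠ u in nhds (0 : ℝ), g (u, 0) = 0)
    (h : g =O[nhds ((0, 0) : ℝ × ℝ)] fun q => q.2 ^ 2) :
    ∀ᶠ u in nhds (0 : ℝ), pv g (u, 0) = 0 := by
  obtain ⟨C, hC⟩ := h.bound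
  filter_upwards [hC.curry_nhds, h0] with u hu hu0
  have hO : (fun t => g (u, t)) =O[nhds (0 : ℝ)] fun t => t ^ 2 := .of_bound C hu
  have ho : (fun t => g (u, t)) =o[nhds (0 : ℝ)] fun t => t :=
    hO.trans_isLittleO (Asymptotics.isLittleO_pow_id (by norm_num))
  have hd : HasDerivAt (fun t => g (u, t)) 0 0 := by
    rw [hasDerivAt_iff_isLittleO]
    simpa [hu0] using ho
  exact (hasDerivAt_slice_snd hg u 0).unique hd

end SmoothMaps

theorem pv_inner {a b : ℝ × ℝ → E3} (ha : ContDiff ℝ (⊤ : ℕ∞) a) (hb : ContDiff ℝ (⊤ : ℕ∞) b)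
    (q : ℝ × ℝ) :
    pv (fun x => (⟪a x, b x⟫ : ℝ)) q = ⟪a q, pv b q⟫ + ⟪pv a q, b q⟫ :=
  fderiv_inner_apply ℝ (ha.differentiableAt_of_top q) (hb.differentiableAt_of_top q) (0, 1)

theorem inner_cross3 (a b c : E3) : (⟪c, cross3 a b⟫ : ℝ) = det3 a b c := by
  simp [cross3, det3, PiLp.inner_apply, Fin.sum_univ_three, Matrix.det_fin_three]
  ring

section Frontal

variable {f ν : ℝ × ℝ → E3}

theorem Nc_eq_neg_inner (hf : ContDiff ℝ (⊤ : ℕ∞) f) (hν : ContDiff ℝ (⊤ : ℕ∞) ν)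
    (h : ∀ q, (⟪ν q, pv f q⟫ : ℝ) = 0) : Nc f ν = fun q => -(⟪pv f q, pv ν q⟫ : ℝ) := by
  funext q
  have h1 := pv_inner hν (contDiff_pv hf) q
  have h2 : pv (fun x => (⟪ν x, pv f x⟫ : ℝ)) q = 0 := by
    rw [show (fun x => (⟪ν x, pv f x⟫ : ℝ)) = fun _ => 0 from funext h]
    simp [pv]
  rw [h2, real_inner_comm, real_inner_comm (pv f q)] at h1
  simp only [Nc]
  linarith

/-- Along the singular curve, `2 N_v = ⟪f_vvv, ν⟫`. -/
theorem two_mul_pv_Nc (hf : ContDiff ℝ (⊤ : ℕ∞) f) (hν : ContDiff ℝ (⊤ : ℕ∞) ν)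
    (h : ∀ q, (⟪ν q, pv f q⟫ : ℝ) = 0) {q : ℝ × ℝ} (hq : pv f q = 0) :
    2 * pv (Nc f ν) q = ⟪pv (pv (pv f)) q, ν q⟫ := by
  have h1 := pv_inner (contDiff_pv (contDiff_pv hf)) hν q
  have h2 := pv_inner (contDiff_pv hf).neg (contDiff_pv hν) q
  have e1 : pv (Nc f ν) q = ⟪pv (pv f) q, pv ν q⟫ + ⟪pv (pv (pv f)) q, ν q⟫ := h1
  have e2 : pv (Nc f ν) q = -⟪pv (pv f) q, pv ν q⟫ := by
    rw [Nc_eq_neg_inner hf hν h]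
    have hneg : pv (fun x => -pv f x) q = -pv (pv f) q := by
      simp only [pv, fderiv_fun_neg, neg_apply]
      rfl
    rw [hneg] at h2
    simpa [hq] using h2
  linarith

theorem isBigO_snd_Mc (hf : ContDiff ℝ (⊤ : ℕ∞) f) (hν : ContDiff ℝ (⊤ : ℕ∞) ν)
    (h : ∀ᶠ u in nhds (0 : ℝ), pv f (u, 0) = 0) :
    Mc f ν =O[nhds ((0, 0) : ℝ × ℝ)] fun q => q.2 := by
  refine isBigO_snd ((contDiff_pv (contDiff_pu hf)).inner ℝ hν) ?_
  filter_upwards [h.eventually_nhds] with u hu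
  have hz : (fun s => pv f (s, 0)) =ᶠ[nhds u] fun _ => 0 := hu
  have hd : pu (pv f) (u, 0) = 0 :=
    (hasDerivAt_slice_fst (contDiff_pv hf) u 0).unique
      ((hasDerivAt_const u (0 : E3)).congr_of_eventuallyEq hz)
  rw [Mc, pv_pu_eq_pu_pv hf, hd, inner_zero_left]

theorem isBigO_snd_sq_Gc (hf : ContDiff ℝ (⊤ : ℕ∞) f)
    (h : ∀ᶠ u in nhds (0 : ℝ), pv f (u, 0) = 0) :
    Gc f =O[nhds ((0, 0) : ℝ × ℝ)] fun q => q.2 ^ 2 := by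
  refine isBigO_snd_sq ((contDiff_pv hf).inner ℝ (contDiff_pv hf)) ?_ ?_
  · filter_upwards [h] with u hu
    rw [Gc, hu, inner_zero_left]
  · filter_upwards [h] with u hu
    refine (pv_inner (contDiff_pv hf) (contDiff_pv hf) _).trans ?_
    simp [hu]

theorem isBigO_snd_sq_Fc (hf : ContDiff ℝ (⊤ : ℕ∞) f)
    (h : ∀ᶠ u in nhds (0 : ℝ), pv f (u, 0) = 0)
    (horth : ∀ᶠ u in nhds (0 : ℝ), (⟪pu f (u, 0), pv (pv f) (u, 0)⟫ : ℝ) = 0) :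
    Fc f =O[nhds ((0, 0) : ℝ × ℝ)] fun q => q.2 ^ 2 := by
  refine isBigO_snd_sq ((contDiff_pu hf).inner ℝ (contDiff_pv hf)) ?_ ?_
  · filter_upwards [h] with u hu
    rw [Fc, hu, inner_zero_right]
  · filter_upwards [h, horth] with u hu ho
    refine (pv_inner (contDiff_pu hf) (contDiff_pv hf) _).trans ?_
    simp [hu, ho]

theorem eventually_half_le_Ec (hf : ContDiff ℝ (⊤ : ℕ∞) f) (h : ‖pu f (0, 0)‖ = 1) :
    ∀ᶠ q in nhds ((0, 0) : ℝ × ℝ), 1 / 2 ≤ Ec f q := by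
  have hc : Continuous (Ec f) := ((contDiff_pu hf).inner ℝ (contDiff_pu hf)).continuous
  refine (hc.tendsto (0, 0)).eventually_const_le ?_
  simp only [Ec, real_inner_self_eq_norm_sq, h]
  norm_num

theorem eventually_half_abs_snd_le_norm_pv (hf : ContDiff ℝ (⊤ : ℕ∞) f)
    (h : ∀ᶠ u in nhds (0 : ℝ), pv f (u, 0) = 0) (hvv : ‖pv (pv f) (0, 0)‖ = 1) :
    ∀ᶠ q in nhds ((0, 0) : ℝ × ℝ), |q.2| / 2 ≤ ‖pv f q‖ := by
  have h1 := contDiff_pv hf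
  have h2 := contDiff_pv h1
  have hr : ContDiff ℝ (⊤ : ℕ∞) fun q : ℝ × ℝ => pv f q - q.2 • pv (pv f) q :=
    h1.sub (contDiff_snd.smul h2)
  have hO : (fun q : ℝ × ℝ => pv f q - q.2 • pv (pv f) q)
      =O[nhds ((0, 0) : ℝ × ℝ)] fun q => q.2 ^ 2 := by
    refine isBigO_snd_sq hr ?_ (.of_forall fun u => ?_)
    · filter_upwards [h] with u hu
      simp [hu]
    · refine (hasDerivAt_slice_snd hr u 0).unique ?_
      simpa using (hasDerivAt_slice_snd h1 u 0).fun_sub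
        ((hasDerivAt_id' (0 : ℝ)).fun_smul (hasDerivAt_slice_snd h2 u 0))
  have ho : (fun q : ℝ × ℝ => pv f q - q.2 • pv (pv f) q)
      =o[nhds ((0, 0) : ℝ × ℝ)] fun q => q.2 :=
    hO.trans_isLittleO ((Asymptotics.isLittleO_pow_id (by norm_num)).comp_tendsto
      (continuous_snd.tendsto ((0, 0) : ℝ × ℝ)))
  have hge : ∀ᶠ q in nhds ((0, 0) : ℝ × ℝ), 3 / 4 ≤ ‖pv (pv f) q‖ :=
    (h2.continuous.norm.tendsto (0, 0)).eventually_const_le (by rw [hvv]; norm_num)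
  filter_upwards [ho.bound (show (0 : ℝ) < 1 / 4 by norm_num), hge] with q hq hq'
  have htri := norm_sub_norm_le (q.2 • pv (pv f) q) (pv f q)
  rw [norm_sub_rev, norm_smul] at htri
  rw [Real.norm_eq_abs] at htri hq
  nlinarith [abs_nonneg q.2]

theorem snd_sq_isBigO_discriminant (hf : ContDiff ℝ (⊤ : ℕ∞) f)
    (h : ∀ᶠ u in nhds (0 : ℝ), pv f (u, 0) = 0)
    (horth : ∀ᶠ u in nhds (0 : ℝ), (⟪pu f (u, 0), pv (pv f) (u, 0)⟫ : ℝ) = 0)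
    (hu : ‖pu f (0, 0)‖ = 1) (hvv : ‖pv (pv f) (0, 0)‖ = 1) :
    (fun q : ℝ × ℝ => q.2 ^ 2) =O[nhds ((0, 0) : ℝ × ℝ)]
      fun q => Ec f q * Gc f q - Fc f q ^ 2 := by
  have hF : Fc f =o[nhds ((0, 0) : ℝ × ℝ)] fun q => q.2 :=
    (isBigO_snd_sq_Fc hf h horth).trans_isLittleO
      ((Asymptotics.isLittleO_pow_id (by norm_num)).comp_tendsto
        (continuous_snd.tendsto ((0, 0) : ℝ × ℝ)))
  refine .of_bound 16 ?_
  filter_upwards [hF.bound (show (0 : ℝ) < 1 / 4 by norm_num), eventually_half_le_Ec hf hu,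
    eventually_half_abs_snd_le_norm_pv hf h hvv] with q hFq hEq hGq
  have hG : q.2 ^ 2 / 4 ≤ Gc f q := by
    have h' : (|q.2| / 2) ^ 2 ≤ ‖pv f q‖ ^ 2 := by gcongr
    rw [div_pow, sq_abs] at h'
    simp only [Gc, real_inner_self_eq_norm_sq]
    linarith
  have hF2 : Fc f q ^ 2 ≤ q.2 ^ 2 / 16 := by
    have h' : ‖Fc f q‖ ^ 2 ≤ (1 / 4 * ‖q.2‖) ^ 2 := by gcongr
    rw [mul_pow, Real.norm_eq_abs, Real.norm_eq_abs, sq_abs, sq_abs] at h'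
    linarith
  have hEG : q.2 ^ 2 / 8 ≤ Ec f q * Gc f q := by nlinarith [sq_nonneg q.2]
  rw [Real.norm_eq_abs, abs_of_nonneg (sq_nonneg q.2), Real.norm_eq_abs]
  linarith [le_abs_self (Ec f q * Gc f q - Fc f q ^ 2)]

end Frontal

/-- In adapted coordinates at a singular point of the first kind, the mean curvature is
bounded on the regular points of some neighborhood of the origin if and only if the cuspidal
curvature `κ_c(u) = det(f_u, f_vv, f_vvv)(u,0)` vanishes for all `u` near `0`. -/
theorem mean_curvature_bounded_iff_cuspidal_curvature_vanishes
    (f ν : ℝ × ℝ → E3)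
    (hf : ContDiff ℝ (⊤ : ℕ∞) f) (hν : ContDiff ℝ (⊤ : ℕ∞) ν)
    (hfrontal : ∀ q : ℝ × ℝ, ‖ν q‖ = 1 ∧ ⟪ν q, pu f q⟫ = 0 ∧ ⟪ν q, pv f q⟫ = 0)
    (hadapted : ∀ᶠ u in nhds (0 : ℝ),
      pv f (u, 0) = 0 ∧ ‖pu f (u, 0)‖ = 1 ∧
      ⟪pu f (u, 0), pv (pv f) (u, 0)⟫ = 0 ∧ ‖pv (pv f) (u, 0)‖ = 1 ∧
      ν (u, 0) = cross3 (pu f (u, 0)) (pv (pv f) (u, 0)))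
    (hreg : ∀ᶠ q in nhds ((0, 0) : ℝ × ℝ), q.2 ≠ 0 → Ec f q * Gc f q - Fc f q ^ 2 ≠ 0) :
    (∃ (W : Set (ℝ × ℝ)) (C : ℝ), IsOpen W ∧ (0, 0) ∈ W ∧
        ∀ q ∈ W, Ec f q * Gc f q - Fc f q ^ 2 ≠ 0 → |meanCurv f ν q| ≤ C) ↔
      (∀ᶠ u in nhds (0 : ℝ),
        det3 (pu f (u, 0)) (pv (pv f) (u, 0)) (pv (pv (pv f)) (u, 0)) = 0) := by
  have hv0 : ∀ᶠ u in nhds (0 : ℝ), pv f (u, 0) = 0 := hadapted.mono fun _ h => h.1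
  have horth : ∀ᶠ u in nhds (0 : ℝ), (⟪pu f (u, 0), pv (pv f) (u, 0)⟫ : ℝ) = 0 :=
    hadapted.mono fun _ h => h.2.2.1
  obtain ⟨-, hu1, -, hvv1, -⟩ := hadapted.self_of_nhds
  have hνv : ∀ q, (⟪ν q, pv f q⟫ : ℝ) = 0 := fun q => (hfrontal q).2.2
  have hNsmooth : ContDiff ℝ (⊤ : ℕ∞) (Nc f ν) := (contDiff_pv (contDiff_pv hf)).inner ℝ hν
  have hN0 : ∀ᶠ u in nhds (0 : ℝ), Nc f ν (u, 0) = 0 := by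
    filter_upwards [hv0] with u hu
    simp [Nc_eq_neg_inner hf hν hνv, hu]
  have hcusp : (∀ᶠ u in nhds (0 : ℝ), pv (Nc f ν) (u, 0) = 0) ↔
      ∀ᶠ u in nhds (0 : ℝ),
        det3 (pu f (u, 0)) (pv (pv f) (u, 0)) (pv (pv (pv f)) (u, 0)) = 0 := by
    refine eventually_congr ?_
    filter_upwards [hadapted] with u hu
    rw [← inner_cross3, ← hu.2.2.2.2, ← two_mul_pv_Nc hf hν hνv hu.1]
    simp
  have hE : Ec f =O[nhds ((0, 0) : ℝ × ℝ)] fun _ => (1 : ℝ) :=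
    (((contDiff_pu hf).inner ℝ (contDiff_pu hf)).continuous.tendsto (0, 0)).isBigO_one ℝ
  have hL : Lc f ν =O[nhds ((0, 0) : ℝ × ℝ)] fun _ => (1 : ℝ) :=
    (((contDiff_pu (contDiff_pu hf)).inner ℝ hν).continuous.tendsto (0, 0)).isBigO_one ℝ
  have hM : Mc f ν =O[nhds ((0, 0) : ℝ × ℝ)] fun _ => (1 : ℝ) :=
    (((contDiff_pv (contDiff_pu hf)).inner ℝ hν).continuous.tendsto (0, 0)).isBigO_one ℝ
  have hF := isBigO_snd_sq_Fc hf hv0 horth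
  have hG := isBigO_snd_sq_Gc hf hv0
  have hFM : (fun q => 2 * Fc f q * Mc f ν q) =O[nhds ((0, 0) : ℝ × ℝ)] fun q => q.2 ^ 2 := by
    simpa using (hF.const_mul_left 2).mul hM
  have hGL : (fun q => Gc f q * Lc f ν q) =O[nhds ((0, 0) : ℝ × ℝ)] fun q => q.2 ^ 2 := by
    simpa using hG.mul hL
  rw [← hcusp]
  constructor
  · rintro ⟨W, C, hW, h0W, hbound⟩
    refine eventually_pv_eq_zero_of_isBigO_snd_sq hNsmooth hN0 ?_
    have hD : (fun q => Ec f q * Gc f q - Fc f q ^ 2)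
        =O[nhds ((0, 0) : ℝ × ℝ)] fun q => q.2 ^ 2 := by
      have hF2 : (fun q => Fc f q ^ 2) =O[nhds ((0, 0) : ℝ × ℝ)] fun q => q.2 ^ 2 := by
        have hF1 : Fc f =O[nhds ((0, 0) : ℝ × ℝ)] fun _ => (1 : ℝ) :=
          (((contDiff_pu hf).inner ℝ (contDiff_pv hf)).continuous.tendsto (0, 0)).isBigO_one ℝ
        simpa [pow_two] using hF.mul hF1
      have hEG : (fun q => Ec f q * Gc f q) =O[nhds ((0, 0) : ℝ × ℝ)] fun q => q.2 ^ 2 := by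
        simpa using hE.mul hG
      exact hEG.sub hF2
    have hA : (fun q => Ec f q * Nc f ν q - 2 * Fc f q * Mc f ν q + Gc f q * Lc f ν q)
        =O[nhds ((0, 0) : ℝ × ℝ)] fun q => Ec f q * Gc f q - Fc f q ^ 2 := by
      refine .of_bound (2 * C) ?_
      have haxis : ∀ᶠ q : ℝ × ℝ in nhds (0, 0), pv f (q.1, 0) = 0 ∧ Nc f ν (q.1, 0) = 0 :=
        (continuous_fst.tendsto ((0, 0) : ℝ × ℝ)).eventually (hv0.and hN0)
      filter_upwards [hW.mem_nhds h0W, hreg, haxis] with q hqW hqreg hq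
      by_cases hv : q.2 = 0
      · obtain ⟨u, v⟩ := q
        obtain rfl : v = 0 := hv
        simp only at hq
        simp [Fc, Gc, hq.1, hq.2]
      · have hne := hqreg hv
        have hle := hbound q hqW hne
        rw [meanCurv, abs_div, abs_mul, abs_two,
          div_le_iff₀ (mul_pos two_pos (abs_pos.2 hne))] at hle
        rw [Real.norm_eq_abs, Real.norm_eq_abs]
        linarith
    have hEN : (fun q => Ec f q * Nc f ν q) =O[nhds ((0, 0) : ℝ × ℝ)] fun q => q.2 ^ 2 :=
      (((hA.trans hD).add hFM).sub hGL).congr_left fun q => by ring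
    refine Asymptotics.IsBigO.trans (.of_bound 2 ?_) hEN
    filter_upwards [eventually_half_le_Ec hf hu1] with q hq
    rw [norm_mul, Real.norm_of_nonneg (by linarith : 0 ≤ Ec f q)]
    nlinarith [norm_nonneg (Nc f ν q)]
  · intro hN1
    have hEN : (fun q => Ec f q * Nc f ν q) =O[nhds ((0, 0) : ℝ × ℝ)] fun q => q.2 ^ 2 := by
      simpa using hE.mul (isBigO_snd_sq hNsmooth hN0 hN1)
    obtain ⟨C, hC⟩ := (((hEN.sub hFM).add hGL).trans
      (snd_sq_isBigO_discriminant hf hv0 horth hu1 hvv1)).bound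
    obtain ⟨W, hWC, hW, h0W⟩ := eventually_nhds_iff.1 hC
    refine ⟨W, C / 2, hW, h0W, fun q hq hne => ?_⟩
    have hle := hWC q hq
    rw [Real.norm_eq_abs, Real.norm_eq_abs] at hle
    rw [meanCurv, abs_div, abs_mul, abs_two, div_le_iff₀ (mul_pos two_pos (abs_pos.2 hne))]
    linarith
end
end
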